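/- Let A be a central arrangement admitting a partition π = (π_1, ..., π_s) that is nice (independent, and for every X ∈ L(A) with A_X ≠ ∅ the induced partition π_X contains a singleton block). Then the Orlik–Solomon algebra of A factors as a Z-module: A(A) ≅ (Z ⊕ B(π_1)) ⊗ ... ⊗ (Z ⊕ B(π_s)), where B(π_i) is the free submodule of A^1(A) spanned by the hyperplanes of π_i. Conversely, such a factorization implies π is nice. -/

import Mathlib

open Module Classical

abbrev Hyp (d : ℕ) := Submodule ℝ (Fin d → ℝ)

noncomputable instance (d : ℕ) : DecidableEq (Hyp d) := Classical.decEq _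

def IsLinHyp (d : ℕ) (H : Hyp d) : Prop := finrank ℝ H = d - 1

noncomputable def arrRank (d : ℕ) (S : Finset (Hyp d)) : ℕ :=
  d - finrank ℝ (S.inf id : Hyp d)

def ArrIndep (d : ℕ) (S : Finset (Hyp d)) : Prop := arrRank d S = S.card

def IsCircuit (d : ℕ) (S : Finset (Hyp d)) : Prop :=
  ¬ ArrIndep d S ∧ ∀ H ∈ S, ArrIndep d (S.erase H)

def IsBrokenCircuit (d : ℕ) (A : Finset (Hyp d)) (ord : Hyp d → ℕ)
    (B : Finset (Hyp d)) : Prop :=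
  ∃ H ∈ A, H ∉ B ∧ IsCircuit d (insert H B) ∧ ∀ H' ∈ B, ord H < ord H'

def IsNBC (d : ℕ) (A : Finset (Hyp d)) (ord : Hyp d → ℕ) (S : Finset (Hyp d)) : Prop :=
  S ⊆ A ∧ ArrIndep d S ∧ ∀ B ⊆ S, ¬ IsBrokenCircuit d A ord B

def arrComplement (d : ℕ) (A : Finset (Hyp d)) : Set (Fin d → ℝ) :=
  {x | ∀ H ∈ A, x ∉ (H : Set (Fin d → ℝ))}

noncomputable def numChambers (d : ℕ) (A : Finset (Hyp d)) : ℕ :=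
  Nat.card (ConnectedComponents (arrComplement d A))

structure SSFiltration (d : ℕ) (A : Finset (Hyp d)) (𝒜 : ℕ → Finset (Hyp d)) : Prop where
  zero : 𝒜 0 = ∅
  top : 𝒜 d = A
  mono : ∀ i < d, 𝒜 i ⊆ 𝒜 (i + 1)
  hyp : ∀ H ∈ A, IsLinHyp d H
  rank : ∀ i, 1 ≤ i → i ≤ d → arrRank d (𝒜 i) = i
  ss : ∀ i, 2 ≤ i → i ≤ d → ∀ H ∈ 𝒜 i, ∀ H' ∈ 𝒜 i, H ≠ H' →
    ∃ H'' ∈ 𝒜 (i - 1), H ⊓ H' ≤ H''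

def CompatOrder (d : ℕ) (𝒜 : ℕ → Finset (Hyp d)) (ord : Hyp d → ℕ) : Prop :=
  ∀ i j : ℕ, ∀ H ∈ 𝒜 i \ 𝒜 (i - 1), ∀ H' ∈ 𝒜 j \ 𝒜 (j - 1), i < j → ord H < ord H'

-- complexification
noncomputable def complexify (d : ℕ) (H : Hyp d) : Submodule ℂ (Fin d → ℂ) :=
  Submodule.span ℂ ((fun x : Fin d → ℝ => (fun i => (x i : ℂ))) '' (H : Set (Fin d → ℝ)))

def cxComplement (d : ℕ) (A : Finset (Hyp d)) : Set (Fin d → ℂ) :=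
  {z | ∀ H ∈ A, z ∉ (complexify d H : Set (Fin d → ℂ))}

open scoped TensorProduct

/-- The generator of the exterior algebra corresponding to the hyperplane `H ∈ A`. -/
noncomputable def gen (d : ℕ) (A : Finset (Hyp d)) (H : ↥A) :
    ExteriorAlgebra ℤ (↥A → ℤ) :=
  ExteriorAlgebra.ι ℤ (Pi.single H 1)

/-- A list of hyperplanes is dependent if the rank of its underlying set is smaller
than its length. -/
def DepList (d : ℕ) (l : List (Hyp d)) : Prop := arrRank d l.toFinset < l.length

/-- The Orlik–Solomon boundary `∂(e_{H_1} ⋯ e_{H_k}) = Σ (-1)^i e_{H_1} ⋯ ê_i ⋯ e_{H_k}`. -/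
noncomputable def osBoundary (d : ℕ) (A : Finset (Hyp d)) (l : List ↥A) :
    ExteriorAlgebra ℤ (↥A → ℤ) :=
  ∑ i ∈ Finset.range l.length, ((-1 : ℤ) ^ i) • ((l.eraseIdx i).map (gen d A)).prod

/-- The defining relations of the Orlik–Solomon algebra: the boundaries of dependent
tuples are set to zero. -/
def osRel (d : ℕ) (A : Finset (Hyp d)) :
    ExteriorAlgebra ℤ (↥A → ℤ) → ExteriorAlgebra ℤ (↥A → ℤ) → Prop :=
  fun u v => v = 0 ∧ ∃ l : List ↥A, DepList d (l.map Subtype.val) ∧ u = osBoundary d A l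

/-- The Orlik–Solomon algebra of `A` (over ℤ). -/
noncomputable abbrev OS (d : ℕ) (A : Finset (Hyp d)) := RingQuot (osRel d A)

/-- The submodule `B(π_i)` of `A^1(A)` spanned by the (classes of the) generators of
the hyperplanes of the block `π i`. -/
noncomputable def Bsub (d : ℕ) (A : Finset (Hyp d)) {s : ℕ} (π : Fin s → Finset (Hyp d))
    (i : Fin s) : Submodule ℤ (OS d A) :=
  Submodule.span ℤ
    ((fun H : ↥A => RingQuot.mkAlgHom ℤ (osRel d A) (gen d A H)) '' {H | H.1 ∈ π i})

/-- The canonical multiplication map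
`(ℤ ⊕ B(π_1)) ⊗ ⋯ ⊗ (ℤ ⊕ B(π_s)) → A(A)`, `(a_i, b_i)_i ↦ ∏ (a_i · 1 + b_i)`. -/
noncomputable def teraoMap (d : ℕ) (A : Finset (Hyp d)) {s : ℕ}
    (π : Fin s → Finset (Hyp d)) :
    (⨂[ℤ] i : Fin s, (ℤ × ↥(Bsub d A π i))) →ₗ[ℤ] OS d A :=
  PiTensorProduct.lift ((MultilinearMap.mkPiAlgebraFin ℤ s (OS d A)).compLinearMap
    (fun i => (LinearMap.fst ℤ ℤ ↥(Bsub d A π i)).smulRight (1 : OS d A) +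
      (Bsub d A π i).subtype.comp (LinearMap.snd ℤ ℤ ↥(Bsub d A π i))))

/-! ### Exterior algebra preliminaries -/

abbrev EA (d : ℕ) (A : Finset (Hyp d)) := ExteriorAlgebra ℤ (↥A → ℤ)

noncomputable def mon (d : ℕ) (A : Finset (Hyp d)) (l : List ↥A) : EA d A :=
  (l.map (gen d A)).prod

noncomputable def ctr (d : ℕ) (A : Finset (Hyp d)) (f : Module.Dual ℤ (↥A → ℤ)) :
    EA d A →ₗ[ℤ] EA d A := CliffordAlgebra.contractLeft f

noncomputable def pr (d : ℕ) (A : Finset (Hyp d)) (H : ↥A) : Module.Dual ℤ (↥A → ℤ) :=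
  LinearMap.proj H

noncomputable def sumF (d : ℕ) (A : Finset (Hyp d)) : Module.Dual ℤ (↥A → ℤ) :=
  ∑ H, pr d A H

noncomputable def eps (d : ℕ) (A : Finset (Hyp d)) : EA d A →ₐ[ℤ] ℤ :=
  ExteriorAlgebra.algebraMapInv

noncomputable def phi (d : ℕ) (A : Finset (Hyp d)) : List ↥A → (EA d A →ₗ[ℤ] ℤ)
  | [] => (eps d A).toLinearMap
  | H :: l => (phi d A l).comp (ctr d A (pr d A H))

section ext
variable {d : ℕ} {A : Finset (Hyp d)}

lemma mon_nil : mon d A [] = 1 := rfl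

lemma mon_cons (H : ↥A) (l : List ↥A) : mon d A (H :: l) = gen d A H * mon d A l := by
  simp [mon]

lemma ctr_iota_mul (f : Module.Dual ℤ (↥A → ℤ)) (v : ↥A → ℤ) (x : EA d A) :
    ctr d A f (ExteriorAlgebra.ι ℤ v * x) = f v • x - ExteriorAlgebra.ι ℤ v * ctr d A f x :=
  CliffordAlgebra.contractLeft_ι_mul (Q := (0 : QuadraticForm ℤ (↥A → ℤ))) f v x

lemma ctr_one (f : Module.Dual ℤ (↥A → ℤ)) : ctr d A f 1 = 0 :=
  CliffordAlgebra.contractLeft_one (Q := (0 : QuadraticForm ℤ (↥A → ℤ))) f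

lemma ctr_ctr (f : Module.Dual ℤ (↥A → ℤ)) (x : EA d A) : ctr d A f (ctr d A f x) = 0 :=
  CliffordAlgebra.contractLeft_contractLeft (Q := (0 : QuadraticForm ℤ (↥A → ℤ))) f x

lemma pr_single (H K : ↥A) : pr d A H (Pi.single K 1) = if H = K then 1 else 0 := by
  simp [pr, Pi.single_apply]

lemma sumF_single (K : ↥A) : sumF d A (Pi.single K 1) = 1 := by
  simp [sumF, LinearMap.sum_apply, pr_single]

lemma ctr_gen_mul (f : Module.Dual ℤ (↥A → ℤ)) (H : ↥A) (x : EA d A) :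
    ctr d A f (gen d A H * x) = f (Pi.single H 1) • x - gen d A H * ctr d A f x :=
  ctr_iota_mul f _ x

lemma bd_gen_mul (H : ↥A) (x : EA d A) :
    ctr d A (sumF d A) (gen d A H * x) = x - gen d A H * ctr d A (sumF d A) x := by
  rw [ctr_gen_mul, sumF_single, one_smul]

lemma ctr_prod_zero (f : Module.Dual ℤ (↥A → ℤ)) (L : List (↥A → ℤ)) (h : ∀ v ∈ L, f v = 0) :
    ctr d A f (L.map (ExteriorAlgebra.ι ℤ)).prod = 0 := by
  induction L with
  | nil => simpa using ctr_one f
  | cons v L ih =>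
    rw [List.map_cons, List.prod_cons, ctr_iota_mul, h v (by simp), ih (fun w hw => h w (by simp [hw]))]
    simp

lemma gen_sq (H : ↥A) : gen d A H * gen d A H = 0 := ExteriorAlgebra.ι_sq_zero _

lemma gen_swap (H K : ↥A) : gen d A H * gen d A K = - (gen d A K * gen d A H) :=
  eq_neg_of_add_eq_zero_left (ExteriorAlgebra.ι_add_mul_swap _ _)

lemma gen_mul_mon_zero (H : ↥A) (l : List ↥A) (h : H ∈ l) : gen d A H * mon d A l = 0 := by
  induction l with
  | nil => simp at h
  | cons K l ih =>
    rw [mon_cons, ← mul_assoc]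
    by_cases hK : H = K
    · subst hK; rw [gen_sq, zero_mul]
    · rw [gen_swap, neg_mul, mul_assoc, ih (by simpa [hK] using h)]; simp

lemma mon_perm {l l' : List ↥A} (h : l.Perm l') : ∃ e : ℤ, mon d A l = e • mon d A l' := by
  induction h with
  | nil => exact ⟨1, by simp⟩
  | cons H _ ih =>
    obtain ⟨e, he⟩ := ih
    exact ⟨e, by rw [mon_cons, mon_cons, he, mul_smul_comm]⟩
  | swap H K l =>
    refine ⟨-1, ?_⟩
    simp only [mon_cons]
    rw [← mul_assoc, gen_swap, neg_mul, mul_assoc, neg_one_smul]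
  | trans _ _ ih1 ih2 =>
    obtain ⟨e, he⟩ := ih1
    obtain ⟨e', he'⟩ := ih2
    exact ⟨e * e', by rw [he, he', smul_smul]⟩

lemma ctr_pr_zero (H : ↥A) (l : List ↥A) (h : H ∉ l) : ctr d A (pr d A H) (mon d A l) = 0 := by
  induction l with
  | nil => exact ctr_one _
  | cons K l ih =>
    rw [mon_cons, ctr_gen_mul, pr_single, if_neg (fun e => h (by simp [e])),
      ih (fun e => h (by simp [e]))]
    simp

lemma ctr_pr_erase (H : ↥A) (l : List ↥A) (hn : l.Nodup) (h : H ∈ l) :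
    ∃ e : ℤ, ctr d A (pr d A H) (mon d A l) = e • mon d A (l.erase H) := by
  induction l with
  | nil => simp at h
  | cons K l ih =>
    rw [List.nodup_cons] at hn
    rw [mon_cons, ctr_gen_mul, pr_single]
    by_cases hK : H = K
    · subst hK
      exact ⟨1, by rw [ctr_pr_zero H l hn.1]; simp⟩
    · obtain ⟨e, he⟩ := ih hn.2 (by simpa [hK] using h)
      refine ⟨-e, ?_⟩
      rw [List.erase_cons_tail (by simpa using Ne.symm hK), mon_cons, he,
        if_neg hK, zero_smul, zero_sub, mul_smul_comm, neg_smul]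

lemma phi_nil (x : EA d A) : phi d A [] x = eps d A x := rfl
lemma phi_cons (H : ↥A) (l : List ↥A) (x : EA d A) :
    phi d A (H :: l) x = phi d A l (ctr d A (pr d A H) x) := rfl

lemma eps_gen (H : ↥A) : eps d A (gen d A H) = 0 := by
  simp [eps, gen, ExteriorAlgebra.algebraMapInv]

lemma phi_perm (l l' : List ↥A) (hn : l'.Nodup) (h : phi d A l (mon d A l') ≠ 0) :
    l.Perm l' := by
  induction l generalizing l' with
  | nil =>
    cases l' with
    | nil => exact List.Perm.nil
    | cons K l' =>
      exfalso; apply h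
      rw [phi_nil, mon_cons, map_mul, eps_gen, zero_mul]
  | cons H l ih =>
    rw [phi_cons] at h
    by_cases hH : H ∈ l'
    · obtain ⟨e, he⟩ := ctr_pr_erase H l' hn hH
      rw [he, map_smul] at h
      have := ih (l'.erase H) (hn.erase H) (fun h0 => h (by rw [h0, smul_zero]))
      exact (this.cons H).trans (List.perm_cons_erase hH).symm
    · rw [ctr_pr_zero H l' hH, map_zero] at h
      exact absurd rfl h

lemma phi_self (l : List ↥A) (hn : l.Nodup) : phi d A l (mon d A l) = 1 := by
  induction l with
  | nil => simp [phi_nil, mon_nil]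
  | cons H l ih =>
    rw [List.nodup_cons] at hn
    rw [phi_cons, mon_cons, ctr_gen_mul, pr_single, ctr_pr_zero H l hn.1]
    simp [ih hn.2]

lemma ctr_mon_mem (f : Module.Dual ℤ (↥A → ℤ)) (l : List ↥A) :
    ctr d A f (mon d A l) ∈
      Submodule.span ℤ (mon d A '' {l' | l'.Sublist l ∧ l'.length + 1 = l.length}) := by
  induction l with
  | nil => rw [mon_nil, ctr_one]; exact zero_mem _
  | cons H l ih =>
    rw [mon_cons, ctr_gen_mul]
    refine sub_mem (Submodule.smul_mem _ _ (Submodule.subset_span ⟨l, ⟨by simp, by simp⟩, rfl⟩)) ?_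
    have : ∀ x ∈ Submodule.span ℤ (mon d A '' {l' | l'.Sublist l ∧ l'.length + 1 = l.length}),
        gen d A H * x ∈ Submodule.span ℤ
          (mon d A '' {l' | l'.Sublist (H :: l) ∧ l'.length + 1 = (H :: l).length}) := by
      intro x hx
      induction hx using Submodule.span_induction with
      | mem x hx =>
        obtain ⟨l', ⟨h1, h2⟩, rfl⟩ := hx
        rw [← mon_cons]
        exact Submodule.subset_span ⟨H :: l', ⟨by simpa using h1, by simpa using h2⟩, rfl⟩
      | zero => simp
      | add x y _ _ hx hy => rw [mul_add]; exact add_mem hx hy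
      | smul a x _ hx => rw [mul_smul_comm]; exact Submodule.smul_mem _ _ hx
    exact this _ ih

lemma iota_eq_sum (v : ↥A → ℤ) :
    ExteriorAlgebra.ι ℤ v = ∑ H, v H • gen d A H := by
  conv_lhs => rw [← Finset.univ_sum_single v]
  rw [map_sum]
  refine Finset.sum_congr rfl fun H _ => ?_
  rw [gen, ← map_smul]
  congr 1
  ext K
  simp [Pi.single_apply]

lemma mon_span : Submodule.span ℤ (Set.range (mon d A)) = ⊤ := by
  rw [eq_top_iff]
  intro x _
  induction x using CliffordAlgebra.left_induction with
  | algebraMap r =>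
    rw [Algebra.algebraMap_eq_smul_one]
    exact Submodule.smul_mem _ _ (Submodule.subset_span ⟨[], rfl⟩)
  | add x y hx hy => exact add_mem (hx trivial) (hy trivial)
  | ι_mul x v hx =>
    replace hx := hx trivial
    change ExteriorAlgebra.ι ℤ v * x ∈ _
    rw [iota_eq_sum, Finset.sum_mul]
    refine sum_mem fun H _ => ?_
    rw [smul_mul_assoc]
    refine Submodule.smul_mem _ _ ?_
    clear * - hx
    induction hx using Submodule.span_induction with
    | mem x hx =>
      obtain ⟨l', rfl⟩ := hx
      rw [← mon_cons]
      exact Submodule.subset_span ⟨_, rfl⟩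
    | zero => simp
    | add x y _ _ hx hy => rw [mul_add]; exact add_mem hx hy
    | smul a x _ hx => rw [mul_smul_comm]; exact Submodule.smul_mem _ _ hx

lemma osBoundary_eq (l : List ↥A) : osBoundary d A l = ctr d A (sumF d A) (mon d A l) := by
  induction l with
  | nil => simp [osBoundary, mon_nil, ctr_one]
  | cons H l ih =>
    rw [mon_cons, bd_gen_mul, ← ih]
    simp only [osBoundary, List.length_cons]
    rw [Finset.sum_range_succ', add_comm]
    simp only [List.eraseIdx_cons_zero, List.eraseIdx_cons_succ, List.map_cons, List.prod_cons,
      pow_zero, one_smul, Finset.mul_sum, sub_eq_add_neg, ← Finset.sum_neg_distrib]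
    congr 1
    refine Finset.sum_congr rfl fun i _ => ?_
    rw [mul_smul_comm, pow_succ, mul_neg_one, neg_smul]

/-- restriction to the hyperplanes satisfying `p` -/
noncomputable def rho (d : ℕ) (A : Finset (Hyp d)) (p : ↥A → Prop) : EA d A →ₐ[ℤ] EA d A :=
  ExteriorAlgebra.map
    { toFun := fun v H => if p H then v H else 0
      map_add' := by intro v w; ext H; by_cases h : p H <;> simp [h]
      map_smul' := by intro v w; ext H; by_cases h : p H <;> simp [h] }

lemma rho_gen (p : ↥A → Prop) (H : ↥A) : rho d A p (gen d A H) = if p H then gen d A H else 0 := by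
  rw [rho, gen, ExteriorAlgebra.map_apply_ι]
  split_ifs with h
  · congr 1
    ext K
    by_cases hK : K = H
    · subst hK; simp [h]
    · simp [hK]
  · rw [← map_zero (ExteriorAlgebra.ι ℤ)]
    congr 1
    ext K
    by_cases hK : K = H
    · subst hK; simp [h]
    · simp [hK]

lemma rho_mon (p : ↥A → Prop) (l : List ↥A) (h : ∀ H ∈ l, p H) :
    rho d A p (mon d A l) = mon d A l := by
  induction l with
  | nil => simp [mon_nil]
  | cons H l ih =>
    rw [mon_cons, map_mul, rho_gen, if_pos (h H (by simp)), ih (fun K hK => h K (by simp [hK]))]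

lemma rho_mon_zero (p : ↥A → Prop) (l : List ↥A) (h : ∃ H ∈ l, ¬ p H) :
    rho d A p (mon d A l) = 0 := by
  induction l with
  | nil => simp at h
  | cons H l ih =>
    rw [mon_cons, map_mul, rho_gen]
    split_ifs with hp
    · rw [ih, mul_zero]
      obtain ⟨K, hK, hKp⟩ := h
      rcases List.mem_cons.1 hK with rfl | hK
      · exact absurd hp hKp
      · exact ⟨K, hK, hKp⟩
    · rw [zero_mul]

end ext
/-! ### The Orlik–Solomon algebra -/

noncomputable abbrev mkOS (d : ℕ) (A : Finset (Hyp d)) : EA d A →ₐ[ℤ] OS d A :=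
  RingQuot.mkAlgHom ℤ (osRel d A)

section rank
variable {d : ℕ}

lemma finrank_le_d (X : Hyp d) : finrank ℝ X ≤ d := by
  simpa using Submodule.finrank_le X

lemma arrRank_insert_le (S : Finset (Hyp d)) (H : Hyp d) (hH : IsLinHyp d H) :
    arrRank d (insert H S) ≤ arrRank d S + 1 := by
  unfold arrRank IsLinHyp at *
  rw [Finset.inf_insert, id]
  have h1 := Submodule.finrank_sup_add_finrank_inf_eq H (S.inf id)
  have h2 := finrank_le_d (H ⊔ S.inf id)
  have h3 := finrank_le_d (S.inf id)
  omega

lemma arrRank_union_le (S T : Finset (Hyp d)) (hT : ∀ H ∈ T, IsLinHyp d H) :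
    arrRank d (S ∪ T) ≤ arrRank d S + T.card := by
  induction T using Finset.induction_on with
  | empty => simp
  | insert H T hH ih =>
    rw [Finset.union_insert, Finset.card_insert_of_notMem hH]
    have := arrRank_insert_le (S ∪ T) H (hT H (by simp))
    have := ih (fun K hK => hT K (by simp [hK]))
    omega

lemma arrRank_empty : arrRank d ∅ = 0 := by
  unfold arrRank
  rw [Finset.inf_empty]
  simp

lemma arrRank_singleton (hd : 0 < d) (H : Hyp d) (hH : IsLinHyp d H) : arrRank d {H} = 1 := by
  unfold arrRank IsLinHyp at *
  rw [Finset.inf_singleton, id, hH]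
  omega

lemma arrRank_le_card (T : Finset (Hyp d)) (hT : ∀ H ∈ T, IsLinHyp d H) :
    arrRank d T ≤ T.card := by
  have := arrRank_union_le ∅ T hT
  rw [arrRank_empty] at this
  simpa using this

lemma arrRank_insert_lt (S : Finset (Hyp d)) (X H : Hyp d) (hS : ∀ K ∈ S, X ≤ K) (hH : ¬ X ≤ H) :
    arrRank d S + 1 ≤ arrRank d (insert H S) := by
  unfold arrRank
  rw [Finset.inf_insert, id]
  have h1 : X ≤ S.inf id := Finset.le_inf (by simpa using hS)
  have h2 : H ⊓ S.inf id < S.inf id := by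
    refine lt_of_le_of_ne inf_le_right fun h => hH (h1.trans ?_)
    rw [← h]; exact inf_le_left
  have h3 := Submodule.finrank_lt_finrank_of_lt h2
  have h4 := finrank_le_d (S.inf id)
  omega

lemma arrRank_insert_eq (S : Finset (Hyp d)) (H : Hyp d) (hH : S.inf id ≤ H) :
    arrRank d (insert H S) = arrRank d S := by
  unfold arrRank
  rw [Finset.inf_insert, id, inf_eq_right.2 hH]

lemma arrRank_le_of_le (S T : Finset (Hyp d)) (h : ∀ H ∈ S, T.inf id ≤ H) :
    arrRank d S ≤ arrRank d T := by
  unfold arrRank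
  have : T.inf id ≤ S.inf id := Finset.le_inf (by simpa using h)
  have := Submodule.finrank_mono this
  omega

end rank

section os
variable {d : ℕ} {A : Finset (Hyp d)}

/-- the set of hyperplanes of a list -/
noncomputable def hs (l : List ↥A) : Finset (Hyp d) := (l.map Subtype.val).toFinset

lemma mem_hs (l : List ↥A) (H : Hyp d) : H ∈ hs l ↔ ∃ K ∈ l, K.1 = H := by
  simp [hs]

lemma hs_cons (H : ↥A) (l : List ↥A) : hs (H :: l) = insert H.1 (hs l) := by
  simp [hs]

lemma hs_card_le (l : List ↥A) : (hs l).card ≤ l.length := by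
  simpa [hs] using List.toFinset_card_le (l.map Subtype.val)

lemma hs_subset (l : List ↥A) : hs l ⊆ A := by
  intro H hH
  obtain ⟨K, _, rfl⟩ := (mem_hs l H).1 hH
  exact K.2

lemma rank_hs_le (hhyp : ∀ H ∈ A, IsLinHyp d H) (l : List ↥A) : arrRank d (hs l) ≤ l.length :=
  (arrRank_le_card _ (fun H hH => hhyp H (hs_subset l hH))).trans (hs_card_le l)

lemma depList_iff (l : List ↥A) : DepList d (l.map Subtype.val) ↔ arrRank d (hs l) < l.length := by
  unfold DepList hs
  rw [List.length_map]

lemma mk_lift {B : Type*} [Ring B] [Algebra ℤ B] (f : EA d A →ₐ[ℤ] B)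
    (h : ∀ l : List ↥A, arrRank d (hs l) < l.length → f (ctr d A (sumF d A) (mon d A l)) = 0)
    {x y : EA d A} (hxy : mkOS d A x = mkOS d A y) : f x = f y := by
  have w : ∀ ⦃x y⦄, osRel d A x y → f x = f y := by
    rintro u v ⟨rfl, l, hl, rfl⟩
    rw [osBoundary_eq, map_zero]
    exact h l ((depList_iff l).1 hl)
  rw [← RingQuot.liftAlgHom_mkAlgHom_apply ℤ f w, ← RingQuot.liftAlgHom_mkAlgHom_apply ℤ f w]
  exact congrArg _ hxy

lemma mk_bd_dep (l : List ↥A) (h : arrRank d (hs l) < l.length) :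
    mkOS d A (ctr d A (sumF d A) (mon d A l)) = 0 := by
  have : osRel d A (osBoundary d A l) 0 := ⟨rfl, l, (depList_iff l).2 h, rfl⟩
  rw [← osBoundary_eq, mkOS, RingQuot.mkAlgHom_rel ℤ this, map_zero]

lemma mk_dep (l : List ↥A) (h : arrRank d (hs l) < l.length) : mkOS d A (mon d A l) = 0 := by
  cases l with
  | nil => simp at h
  | cons H t =>
    have h1 := mk_bd_dep _ h
    have : mon d A (H :: t) = gen d A H * ctr d A (sumF d A) (mon d A (H :: t)) := by
      rw [mon_cons, bd_gen_mul, mul_sub, ← mul_assoc, gen_sq, zero_mul, sub_zero]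
    rw [this, map_mul, h1, mul_zero]

lemma mk_rho (X : Hyp d) {x y : EA d A} (hxy : mkOS d A x = mkOS d A y) :
    mkOS d A (rho d A (fun H => X ≤ H.1) x) = mkOS d A (rho d A (fun H => X ≤ H.1) y) := by
  refine mk_lift ((mkOS d A).comp (rho d A (fun H => X ≤ H.1))) ?_ hxy
  intro l hl
  rw [AlgHom.comp_apply]
  by_cases hall : ∀ H ∈ l, X ≤ H.1
  · have h1 := ctr_mon_mem (sumF d A) l
    have : ∀ x ∈ Submodule.span ℤ (mon d A '' {l' | l'.Sublist l ∧ l'.length + 1 = l.length}),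
        rho d A (fun H => X ≤ H.1) x = x := by
      intro x hx
      induction hx using Submodule.span_induction with
      | mem x hx =>
        obtain ⟨l', ⟨h1, -⟩, rfl⟩ := hx
        exact rho_mon _ _ (fun H hH => hall H (h1.subset hH))
      | zero => simp
      | add x y _ _ hx hy => rw [map_add, hx, hy]
      | smul a x _ hx => rw [map_smul, hx]
    rw [this _ h1]
    exact mk_bd_dep l hl
  · push Not at hall
    obtain ⟨H, hH, hXH⟩ := hall
    rw [← osBoundary_eq]
    unfold osBoundary
    rw [map_sum, map_sum]
    refine Finset.sum_eq_zero fun i hi => ?_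
    rw [map_smul, map_smul]
    change _ • mkOS d A (rho d A _ (mon d A (l.eraseIdx i))) = 0
    by_cases hall : ∀ H ∈ l.eraseIdx i, X ≤ H.1
    · rw [rho_mon _ _ hall, mk_dep, smul_zero]
      have hi : i < l.length := by simpa using hi
      have hperm : (l[i] :: l.eraseIdx i).Perm l := List.getElem_cons_eraseIdx_perm hi
      have h2 : hs l = insert l[i].1 (hs (l.eraseIdx i)) := by
        rw [← hs_cons]
        ext K
        simp only [mem_hs]
        constructor
        · rintro ⟨a, ha, rfl⟩; exact ⟨a, hperm.mem_iff.2 ha, rfl⟩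
        · rintro ⟨a, ha, rfl⟩; exact ⟨a, hperm.mem_iff.1 ha, rfl⟩
      have h3 : ¬ X ≤ l[i].1 := by
        intro hle
        apply hXH
        rcases List.mem_cons.1 (hperm.mem_iff.2 hH) with rfl | h
        · exact hle
        · exact hall H h
      have h4 := arrRank_insert_lt (hs (l.eraseIdx i)) X l[i].1 (by
        intro K hK
        obtain ⟨a, ha, rfl⟩ := (mem_hs _ _).1 hK
        exact hall a ha) h3
      rw [← h2] at h4
      rw [List.length_eraseIdx_of_lt hi]
      omega
    · push Not at hall
      rw [rho_mon_zero _ _ hall, map_zero, smul_zero]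

noncomputable def matLin {R V B : Type*} [CommRing R] [AddCommGroup V] [Module R V] [Ring B]
    [Algebra R B] (g : V →ₗ[R] B) (f : V →ₗ[R] R) : V →ₗ[R] Matrix (Fin 2) (Fin 2) B where
  toFun v := !![-g v, f v • 1; 0, g v]
  map_add' v w := by
    ext i j
    fin_cases i <;> fin_cases j <;> simp [add_comm, add_smul]
  map_smul' a v := by
    ext i j
    fin_cases i <;> fin_cases j <;> simp [mul_smul]

lemma matLin_sq {R V B : Type*} [CommRing R] [AddCommGroup V] [Module R V] [Ring B]
    [Algebra R B] (g : V →ₗ[R] B) (f : V →ₗ[R] R) (h : ∀ v, g v * g v = 0) (v : V) : matLin g f v * matLin g f v = 0 := by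
  change !![-g v, f v • 1; 0, g v] * !![-g v, f v • 1; 0, g v] = 0
  rw [Matrix.mul_fin_two]
  ext i j
  fin_cases i <;> fin_cases j <;> simp [h]

/-- auxiliary algebra map used to show that the boundary descends -/
noncomputable def PhiM (d : ℕ) (A : Finset (Hyp d)) :
    EA d A →ₐ[ℤ] Matrix (Fin 2) (Fin 2) (OS d A) :=
  ExteriorAlgebra.lift ℤ
    ⟨matLin ((mkOS d A).toLinearMap ∘ₗ ExteriorAlgebra.ι ℤ) (sumF d A),
      matLin_sq _ _ (fun v => by
        change mkOS d A _ * mkOS d A _ = 0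
        rw [← map_mul, ExteriorAlgebra.ι_sq_zero, map_zero])⟩

lemma PhiM_iota (v : ↥A → ℤ) : PhiM d A (ExteriorAlgebra.ι ℤ v) =
    !![-mkOS d A (ExteriorAlgebra.ι ℤ v), sumF d A v • 1;
          0, mkOS d A (ExteriorAlgebra.ι ℤ v)] := by
  rw [PhiM, ExteriorAlgebra.lift_ι_apply]; rfl

lemma PhiM_entries (x : EA d A) : PhiM d A x 0 1 = mkOS d A (ctr d A (sumF d A) x) ∧
    PhiM d A x 1 0 = 0 ∧ PhiM d A x 1 1 = mkOS d A x := by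
  induction x using CliffordAlgebra.left_induction with
  | algebraMap r =>
    change PhiM d A (algebraMap ℤ (EA d A) r) 0 1 = mkOS d A (ctr d A _ (algebraMap ℤ (EA d A) r)) ∧
      PhiM d A (algebraMap ℤ (EA d A) r) 1 0 = 0 ∧
      PhiM d A (algebraMap ℤ (EA d A) r) 1 1 = mkOS d A (algebraMap ℤ (EA d A) r)
    rw [Algebra.algebraMap_eq_smul_one, map_smul, map_smul, map_smul, map_one (PhiM d A), ctr_one]
    simp
  | add x y hx hy =>
    obtain ⟨h1, h2, h3⟩ := hx
    obtain ⟨h1', h2', h3'⟩ := hy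
    refine ⟨?_, ?_, ?_⟩
    · rw [map_add, Matrix.add_apply, h1, h1', map_add, map_add]
    · rw [map_add, Matrix.add_apply, h2, h2', add_zero]
    · rw [map_add, Matrix.add_apply, h3, h3', map_add]
  | ι_mul x v hx =>
    obtain ⟨h1, h2, h3⟩ := hx
    change PhiM d A (ExteriorAlgebra.ι ℤ v * x) 0 1 =
      mkOS d A (ctr d A _ (ExteriorAlgebra.ι ℤ v * x)) ∧
      PhiM d A (ExteriorAlgebra.ι ℤ v * x) 1 0 = 0 ∧
      PhiM d A (ExteriorAlgebra.ι ℤ v * x) 1 1 = mkOS d A (ExteriorAlgebra.ι ℤ v * x)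
    rw [map_mul, PhiM_iota, ctr_iota_mul]
    simp only [Matrix.mul_apply, Fin.sum_univ_two, h1, h2, h3]
    refine ⟨?_, ?_, ?_⟩
    · have e := map_smul (mkOS d A) (sumF d A v) x
      rw [map_sub, map_mul]
      refine Eq.trans ?_ (congrArg (fun z => z - _) e.symm)
      simp only [Matrix.of_apply, Matrix.cons_val_zero, Matrix.cons_val_one,
        smul_mul_assoc, one_mul, neg_mul]
      abel
    · simp
    · simp

lemma PhiM_zero (l : List ↥A) :
    PhiM d A (mon d A l) 0 0 = (-1 : ℤ) ^ l.length • mkOS d A (mon d A l) := by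
  induction l with
  | nil => simp [mon_nil]
  | cons H l ih =>
    rw [mon_cons, map_mul, Matrix.mul_apply, Fin.sum_univ_two, ih, (PhiM_entries _).2.1,
      mul_zero, add_zero, gen, PhiM_iota, map_mul]
    simp only [Matrix.of_apply, Matrix.cons_val_zero, List.length_cons]
    rw [mul_smul_comm, pow_succ, mul_neg_one, neg_smul, neg_mul, smul_neg]

lemma mk_bd {x y : EA d A} (hxy : mkOS d A x = mkOS d A y) :
    mkOS d A (ctr d A (sumF d A) x) = mkOS d A (ctr d A (sumF d A) y) := by
  rw [← (PhiM_entries x).1, ← (PhiM_entries y).1]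
  refine congrFun (congrFun (mk_lift (PhiM d A) ?_ hxy) 0) 1
  intro l hl
  have h0 := mk_bd_dep l hl
  have h1 : ∀ x ∈ Submodule.span ℤ (mon d A '' {l' | l'.Sublist l ∧ l'.length + 1 = l.length}),
      PhiM d A x 0 0 = (-1 : ℤ) ^ (l.length - 1) • mkOS d A x := by
    intro x hx
    induction hx using Submodule.span_induction with
    | mem x hx =>
      obtain ⟨l', ⟨-, h2⟩, rfl⟩ := hx
      rw [PhiM_zero, ← h2, Nat.add_sub_cancel]
    | zero => simp
    | add x y _ _ hx hy => rw [map_add, Matrix.add_apply, hx, hy, map_add, smul_add]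
    | smul a x _ hx => rw [map_smul, Matrix.smul_apply, hx, map_smul, smul_comm]
  obtain ⟨e1, e2, e3⟩ := PhiM_entries (ctr d A (sumF d A) (mon d A l))
  have e0 := h1 _ (ctr_mon_mem (sumF d A) l)
  rw [h0, smul_zero] at e0
  rw [h0] at e3
  rw [ctr_ctr, map_zero] at e1
  ext i j
  fin_cases i <;> fin_cases j
  · exact e0
  · exact e1
  · exact e2
  · exact e3

lemma toTriv_gen (H : ↥A) : ExteriorAlgebra.toTrivSqZeroExt (gen d A H) =
    (TrivSqZeroExt.inr (Pi.single H 1) : TrivSqZeroExt ℤ (↥A → ℤ)) :=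
  ExteriorAlgebra.toTrivSqZeroExt_ι _

lemma toTriv_mon (l : List ↥A) (hl : 2 ≤ l.length) :
    (ExteriorAlgebra.toTrivSqZeroExt (mon d A l) : TrivSqZeroExt ℤ (↥A → ℤ)) = 0 := by
  match l, hl with
  | H :: K :: l, _ =>
    rw [mon_cons, mon_cons, map_mul, map_mul, toTriv_gen, toTriv_gen, ← mul_assoc,
      TrivSqZeroExt.inr_mul_inr, zero_mul]

lemma mk_triv (hd : A.Nonempty → 0 < d) (hhyp : ∀ H ∈ A, IsLinHyp d H) {x y : EA d A}
    (hxy : mkOS d A x = mkOS d A y) :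
    (ExteriorAlgebra.toTrivSqZeroExt x : TrivSqZeroExt ℤ (↥A → ℤ)) =
      ExteriorAlgebra.toTrivSqZeroExt y := by
  refine mk_lift ExteriorAlgebra.toTrivSqZeroExt ?_ hxy
  intro l hl
  match l, hl with
  | [], hl => simp at hl
  | [H], hl =>
    exfalso
    have := arrRank_singleton (hd ⟨_, H.2⟩) H.1 (hhyp H.1 H.2)
    simp [hs] at hl
    omega
  | [H, K], hl =>
    have hHK : H = K := by
      by_contra hne
      have h1 := hhyp H.1 H.2
      have h2 := hhyp K.1 K.2
      unfold IsLinHyp at h1 h2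
      have h3 : ¬ K.1 ≤ H.1 := fun hle =>
        hne (Subtype.ext (Submodule.eq_of_le_of_finrank_eq hle (by rw [h1, h2])).symm)
      have h4 := arrRank_insert_lt {K.1} K.1 H.1 (by simp) h3
      have h5 : arrRank d {K.1} = 1 := arrRank_singleton (hd ⟨_, K.2⟩) _ (hhyp K.1 K.2)
      simp [hs] at hl
      omega
    subst hHK
    have : mon d A [H, H] = 0 := by rw [mon_cons, gen_mul_mon_zero _ _ (by simp)]
    rw [this]; simp
  | H :: K :: J :: l, _ =>
    have : ∀ x ∈ Submodule.span ℤ (mon d A '' {l' | l'.Sublist (H :: K :: J :: l) ∧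
        l'.length + 1 = (H :: K :: J :: l).length}),
        (ExteriorAlgebra.toTrivSqZeroExt x : TrivSqZeroExt ℤ (↥A → ℤ)) = 0 := by
      intro x hx
      induction hx using Submodule.span_induction with
      | mem x hx =>
        obtain ⟨l', ⟨-, h1⟩, rfl⟩ := hx
        refine toTriv_mon _ ?_
        simp at h1
        omega
      | zero => simp
      | add x y _ _ hx hy => rw [map_add, hx, hy, add_zero]
      | smul a x _ hx => rw [map_smul, hx, smul_zero]
    exact this _ (ctr_mon_mem _ _)

lemma mk_eps (hd : A.Nonempty → 0 < d) (hhyp : ∀ H ∈ A, IsLinHyp d H) {x y : EA d A}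
    (hxy : mkOS d A x = mkOS d A y) : eps d A x = eps d A y := by
  have h := congrArg TrivSqZeroExt.fst (mk_triv hd hhyp hxy)
  have key : ∀ z : EA d A,
      TrivSqZeroExt.fst (ExteriorAlgebra.toTrivSqZeroExt z : TrivSqZeroExt ℤ (↥A → ℤ)) =
        eps d A z := by
    intro z
    have : ((TrivSqZeroExt.fstHom ℤ ℤ (↥A → ℤ)).comp ExteriorAlgebra.toTrivSqZeroExt) =
        eps d A := by
      apply ExteriorAlgebra.hom_ext
      ext v
      simp [eps, ExteriorAlgebra.algebraMapInv]
    exact congrArg (fun f : EA d A →ₐ[ℤ] ℤ => f z) this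
  rwa [key, key] at h

end os
/-! ### Sections of the partition -/

section sec
variable {d s : ℕ} {A : Finset (Hyp d)}

def Good (blk : ↥A → Fin s) (l : List ↥A) : Prop := (l.map blk).Nodup

abbrev Sec (blk : ↥A → Fin s) := ∀ i : Fin s, Option {H : ↥A // blk H = i}

def sl {blk : ↥A → Fin s} (S : Sec blk) : List ↥A :=
  (List.finRange s).filterMap (fun i => (S i).map Subtype.val)

noncomputable def secM (blk : ↥A → Fin s) : Submodule ℤ (EA d A) :=
  Submodule.span ℤ (mon d A '' {l | Good blk l})

variable {blk : ↥A → Fin s}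

lemma Good.nodup {l : List ↥A} (h : Good blk l) : l.Nodup := List.Nodup.of_map _ h

lemma Good.sublist {l l' : List ↥A} (h : Good blk l) (hl : l'.Sublist l) : Good blk l' :=
  List.Nodup.sublist (hl.map blk) h

lemma mem_sl (S : Sec blk) (H : ↥A) : H ∈ sl S ↔ S (blk H) = some ⟨H, rfl⟩ := by
  simp only [sl, List.mem_filterMap, List.mem_finRange, true_and, Option.map_eq_some_iff]
  constructor
  · rintro ⟨i, ⟨K, hK⟩, h1, rfl⟩
    subst hK
    exact h1
  · intro h
    exact ⟨_, _, h, rfl⟩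

lemma good_sl (S : Sec blk) : Good blk (sl S) := by
  unfold Good sl
  rw [List.map_filterMap]
  refine List.Nodup.filterMap ?_ (List.nodup_finRange s)
  intro i j b hi hj
  simp only [Option.mem_def, Option.map_eq_some_iff] at hi hj
  obtain ⟨_, ⟨⟨K, hK⟩, -, rfl⟩, rfl⟩ := hi
  obtain ⟨_, ⟨⟨K', hK'⟩, -, rfl⟩, h⟩ := hj
  simp only at h
  rw [← hK, ← hK', h]

lemma sl_inj {S S' : Sec blk} (h : (sl S).Perm (sl S')) : S = S' := by
  have key : ∀ H, S (blk H) = some ⟨H, rfl⟩ ↔ S' (blk H) = some ⟨H, rfl⟩ := by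
    intro H; rw [← mem_sl, ← mem_sl]; exact h.mem_iff
  funext i
  apply Option.ext
  rintro ⟨H, rfl⟩
  exact key H

lemma exists_sec {l : List ↥A} (hl : Good blk l) : ∃ S : Sec blk, l.Perm (sl S) := by
  let S : Sec blk := fun i => if h : ∃ H ∈ l, blk H = i then some ⟨h.choose, h.choose_spec.2⟩
    else none
  refine ⟨S, (List.perm_ext_iff_of_nodup hl.nodup (good_sl S).nodup).2 fun H => ?_⟩
  rw [mem_sl]
  constructor
  · intro hH
    have h : ∃ K ∈ l, blk K = blk H := ⟨H, hH, rfl⟩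
    have e : h.choose = H := List.inj_on_of_nodup_map hl h.choose_spec.1 hH h.choose_spec.2
    simp only [S, dif_pos h, Option.some.injEq, Subtype.mk.injEq]
    exact e
  · intro h
    by_cases hh : ∃ K ∈ l, blk K = blk H
    · simp only [S, dif_pos hh, Option.some.injEq, Subtype.mk.injEq] at h
      have := hh.choose_spec.1
      rwa [h] at this
    · simp only [S, dif_neg hh] at h
      cases h

lemma phi_sl (S S' : Sec blk) : phi d A (sl S) (mon d A (sl S')) = if S = S' then 1 else 0 := by
  split_ifs with h
  · subst h; exact phi_self _ (good_sl S).nodup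
  · by_contra hne
    exact h (sl_inj (phi_perm _ _ (good_sl S').nodup hne))

lemma secM_expand (x : EA d A) (hx : x ∈ secM blk) :
    x = ∑ S : Sec blk, phi d A (sl S) x • mon d A (sl S) := by
  induction hx using Submodule.span_induction with
  | mem x hx =>
    obtain ⟨l, hl, rfl⟩ := hx
    obtain ⟨S', hS'⟩ := exists_sec hl
    obtain ⟨e, he⟩ := mon_perm (d := d) hS'
    rw [he]
    rw [Finset.sum_eq_single S']
    · rw [map_smul, phi_sl, if_pos rfl, smul_eq_mul, mul_one]
    · intro S _ hS
      rw [map_smul, phi_sl, if_neg hS, smul_zero, zero_smul]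
    · simp
  | zero => simp
  | add x y _ _ hx hy =>
    simp only [map_add, add_smul, Finset.sum_add_distrib]
    rw [← hx, ← hy]
  | smul a x _ hx =>
    simp only [map_smul, smul_eq_mul, mul_smul]
    rw [← Finset.smul_sum, ← hx]

lemma secM_ctr (f : Module.Dual ℤ (↥A → ℤ)) (x : EA d A) (hx : x ∈ secM blk) :
    ctr d A f x ∈ secM blk := by
  induction hx using Submodule.span_induction with
  | mem x hx =>
    obtain ⟨l, hl, rfl⟩ := hx
    refine Submodule.span_mono (Set.image_mono ?_) (ctr_mon_mem f l)
    rintro l' ⟨h, -⟩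
    exact hl.sublist h
  | zero => simp
  | add x y _ _ hx hy => rw [map_add]; exact add_mem hx hy
  | smul a x _ hx => rw [map_smul]; exact Submodule.smul_mem _ _ hx

lemma secM_rho (p : ↥A → Prop) (x : EA d A) (hx : x ∈ secM blk) :
    rho d A p x ∈ Submodule.span ℤ (mon d A '' {l | Good blk l ∧ ∀ H ∈ l, p H}) := by
  induction hx using Submodule.span_induction with
  | mem x hx =>
    obtain ⟨l, hl, rfl⟩ := hx
    by_cases h : ∀ H ∈ l, p H
    · rw [rho_mon p l h]
      exact Submodule.subset_span ⟨l, ⟨hl, h⟩, rfl⟩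
    · push Not at h
      rw [rho_mon_zero p l h]
      exact zero_mem _
  | zero => simp
  | add x y _ _ hx hy => rw [map_add]; exact add_mem hx hy
  | smul a x _ hx => rw [map_smul]; exact Submodule.smul_mem _ _ hx

lemma secM_rho' (p : ↥A → Prop) (x : EA d A) (hx : x ∈ secM blk) : rho d A p x ∈ secM blk := by
  refine Submodule.span_mono (Set.image_mono ?_) (secM_rho p x hx)
  rintro l ⟨h, -⟩
  exact h

lemma phi_rho (p : ↥A → Prop) (l : List ↥A) (hl : ∀ H ∈ l, p H) (x : EA d A)
    (hx : x ∈ secM blk) : phi d A l (rho d A p x) = phi d A l x := by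
  induction hx using Submodule.span_induction with
  | mem x hx =>
    obtain ⟨l', hl', rfl⟩ := hx
    by_cases h : ∀ H ∈ l', p H
    · rw [rho_mon p l' h]
    · push Not at h
      rw [rho_mon_zero p l' h, map_zero]
      by_contra hne
      have := phi_perm l l' hl'.nodup (Ne.symm hne)
      obtain ⟨H, hH, hp⟩ := h
      exact hp (hl H (this.mem_iff.2 hH))
  | zero => simp
  | add x y _ _ hx hy => rw [map_add, map_add, map_add, hx, hy]
  | smul a x _ hx => rw [map_smul, map_smul, map_smul, hx]

/-- Spanning part of the forward direction. -/
lemma span_fwd (hhyp : ∀ H ∈ A, IsLinHyp d H)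
    (hsing : ∀ l : List ↥A, l ≠ [] → ∃ H : ↥A, (hs l).inf id ≤ H.1 ∧
      ∀ K : ↥A, (hs l).inf id ≤ K.1 → blk K = blk H → K = H) (n : ℕ) :
    ∀ l : List ↥A, l.length = n → mkOS d A (mon d A l) ∈
      Submodule.span ℤ ((fun T => mkOS d A (mon d A T)) ''
        {T | Good blk T ∧ ∀ H ∈ T, (hs l).inf id ≤ H.1}) := by
  induction n with
  | zero =>
    intro l hl
    have : l = [] := List.length_eq_zero_iff.1 hl
    subst this
    exact Submodule.subset_span ⟨[], ⟨by simp [Good], by simp⟩, rfl⟩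
  | succ n ih =>
    intro l hl
    obtain ⟨H, hH, hHu⟩ := hsing l (by rintro rfl; simp at hl)
    have hrk : arrRank d (hs (H :: l)) < (H :: l).length := by
      rw [hs_cons, arrRank_insert_eq _ _ hH, List.length_cons]
      exact Nat.lt_succ_of_le (rank_hs_le hhyp l)
    have h1 := mk_bd_dep _ hrk
    rw [mon_cons, bd_gen_mul, map_sub, sub_eq_zero, map_mul] at h1
    rw [h1]
    have h2 : ∀ x ∈ Submodule.span ℤ (mon d A '' {l' | l'.Sublist l ∧ l'.length + 1 = l.length}),
        mkOS d A x ∈ Submodule.span ℤ ((fun T => mkOS d A (mon d A T)) ''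
        {T | Good blk T ∧ ∀ H ∈ T, (hs l).inf id ≤ H.1}) := by
      intro x hx
      induction hx using Submodule.span_induction with
      | mem x hx =>
        obtain ⟨l', ⟨h3, h4⟩, rfl⟩ := hx
        refine Submodule.span_mono (Set.image_mono ?_) (ih l' (by omega))
        rintro T ⟨hT, hT'⟩
        refine ⟨hT, fun K hK => le_trans (Finset.inf_mono ?_) (hT' K hK)⟩
        intro J hJ
        obtain ⟨a, ha, rfl⟩ := (mem_hs _ _).1 hJ
        exact (mem_hs _ _).2 ⟨a, h3.subset ha, rfl⟩
      | zero => simp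
      | add x y _ _ hx hy => rw [map_add]; exact add_mem hx hy
      | smul a x _ hx => rw [map_smul]; exact Submodule.smul_mem _ _ hx
    have h3 : ∀ y ∈ Submodule.span ℤ ((fun T => mkOS d A (mon d A T)) ''
        {T | Good blk T ∧ ∀ H ∈ T, (hs l).inf id ≤ H.1}),
        mkOS d A (gen d A H) * y ∈ Submodule.span ℤ ((fun T => mkOS d A (mon d A T)) ''
        {T | Good blk T ∧ ∀ H ∈ T, (hs l).inf id ≤ H.1}) := by
      intro x hx
      induction hx using Submodule.span_induction with
      | mem x hx =>
        obtain ⟨T, ⟨h3, h4⟩, rfl⟩ := hx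
        simp only
        rw [← map_mul]
        by_cases hb : ∃ K ∈ T, blk K = blk H
        · obtain ⟨K, hK, hKH⟩ := hb
          have := hHu K (h4 K hK) hKH
          subst this
          rw [gen_mul_mon_zero _ _ hK, map_zero]
          exact zero_mem _
        · rw [← mon_cons]
          refine Submodule.subset_span ⟨H :: T, ⟨?_, ?_⟩, rfl⟩
          · unfold Good
            rw [List.map_cons, List.nodup_cons]
            refine ⟨fun h => hb ?_, h3⟩
            simpa using h
          · intro K hK
            rcases List.mem_cons.1 hK with rfl | hK
            · exact hH
            · exact h4 K hK
      | zero => simp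
      | add x y _ _ hx hy => rw [mul_add]; exact add_mem hx hy
      | smul a x _ hx => rw [mul_smul_comm]; exact Submodule.smul_mem _ _ hx
    exact h3 _ (h2 _ (ctr_mon_mem (sumF d A) l))

/-- Injectivity part of the forward direction. -/
lemma inj_fwd (hd : A.Nonempty → 0 < d) (hhyp : ∀ H ∈ A, IsLinHyp d H)
    (hind : ∀ T : List ↥A, Good blk T → arrRank d (hs T) = T.length)
    (hsing : ∀ l : List ↥A, l ≠ [] → ∃ H : ↥A, (hs l).inf id ≤ H.1 ∧
      ∀ K : ↥A, (hs l).inf id ≤ K.1 → blk K = blk H → K = H) (n : ℕ) :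
    ∀ x ∈ secM blk, mkOS d A x = 0 → ∀ l : List ↥A, Good blk l → l.length = n →
      phi d A l x = 0 := by
  induction n using Nat.strong_induction_on with
  | _ n ih =>
  intro x hx hx0 l hl hln
  by_cases hnil : l = []
  · subst hnil
    rw [phi_nil]
    have := mk_eps hd hhyp (x := x) (y := 0) (by rw [hx0, map_zero])
    rw [this, map_zero]
  obtain ⟨H, hH, hHu⟩ := hsing l hnil
  set X := (hs l).inf id with hX
  have hlX : ∀ K ∈ l, X ≤ K.1 := fun K hK =>
    Finset.inf_le (f := id) ((mem_hs _ _).2 ⟨K, hK, rfl⟩)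
  have hlen : ∀ T : List ↥A, Good blk T → (∀ K ∈ T, X ≤ K.1) → T.length ≤ n := by
    intro T hT hTX
    rw [← hind T hT, ← hln]
    refine le_trans (arrRank_le_of_le _ (hs l) ?_) (rank_hs_le hhyp l)
    intro K hK
    obtain ⟨a, ha, rfl⟩ := (mem_hs _ _).1 hK
    exact hTX a ha
  rw [← phi_rho (fun H => X ≤ H.1) l hlX x hx]
  set x' := rho d A (fun H => X ≤ H.1) x with hx'
  have hx'M : x' ∈ secM blk := secM_rho' _ _ hx
  have hx'0 : mkOS d A x' = 0 := by
    have := mk_rho X (x := x) (y := 0) (by rw [hx0, map_zero])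
    rw [map_zero, map_zero] at this
    exact this
  have hocc : ∀ S : Sec blk, phi d A (sl S) x' ≠ 0 →
      (∀ K ∈ sl S, X ≤ K.1) ∧ (sl S).length = n := by
    intro S hS
    have hSX : ∀ K ∈ sl S, X ≤ K.1 := by
      by_contra hcon
      apply hS
      have hsp := secM_rho (fun H => X ≤ H.1) x hx
      rw [← hx'] at hsp
      clear_value x'
      clear * - hsp hcon
      induction hsp using Submodule.span_induction with
      | mem x hx =>
        obtain ⟨T, ⟨h1, h2⟩, rfl⟩ := hx
        by_contra hne
        have := phi_perm _ _ h1.nodup hne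
        exact hcon fun K hK => h2 K (this.mem_iff.1 hK)
      | zero => simp
      | add x y _ _ hx hy => rw [map_add, hx, hy, add_zero]
      | smul a x _ hx => rw [map_smul, hx, smul_zero]
    refine ⟨hSX, ?_⟩
    by_contra hne
    have h1 := hlen _ (good_sl S) hSX
    exact hS (ih _ (lt_of_le_of_ne h1 hne) x' hx'M hx'0 _ (good_sl S) rfl)
  have hexp := secM_expand x' hx'M
  have hHx : gen d A H * x' = 0 := by
    rw [hexp, Finset.mul_sum]
    refine Finset.sum_eq_zero fun S _ => ?_
    rw [mul_smul_comm]
    by_cases h0 : phi d A (sl S) x' = 0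
    · rw [h0, zero_smul]
    obtain ⟨h1, h2⟩ := hocc S h0
    by_cases hb : ∃ K ∈ sl S, blk K = blk H
    · obtain ⟨K, hK, hKH⟩ := hb
      have := hHu K (h1 K hK) hKH
      subst this
      rw [gen_mul_mon_zero _ _ hK, smul_zero]
    · exfalso
      have := hlen (H :: sl S) (by
        unfold Good
        rw [List.map_cons, List.nodup_cons]
        refine ⟨fun h => hb ?_, good_sl S⟩
        simpa using h) (by
        intro K hK
        rcases List.mem_cons.1 hK with rfl | hK
        · exact hH
        · exact h1 K hK)
      rw [List.length_cons] at this
      omega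
  have hbd : ctr d A (sumF d A) x' = 0 := by
    have hM := secM_ctr (sumF d A) x' hx'M
    rw [secM_expand _ hM]
    refine Finset.sum_eq_zero fun S _ => ?_
    have h0 : mkOS d A (ctr d A (sumF d A) x') = 0 := by
      have := mk_bd (x := x') (y := 0) (by rw [hx'0, map_zero])
      rw [map_zero, map_zero] at this
      exact this
    by_cases hlt : (sl S).length < n
    · rw [ih _ hlt _ hM h0 _ (good_sl S) rfl, zero_smul]
    · have : phi d A (sl S) (ctr d A (sumF d A) x') = 0 := by
        rw [hexp, map_sum, map_sum]
        refine Finset.sum_eq_zero fun S' _ => ?_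
        rw [map_smul, map_smul]
        by_cases h0 : phi d A (sl S') x' = 0
        · rw [h0, zero_smul]
        obtain ⟨h1, h2⟩ := hocc S' h0
        have h3 := ctr_mon_mem (sumF d A) (sl S')
        have h4 : ∀ y ∈ Submodule.span ℤ (mon d A '' {l' | l'.Sublist (sl S') ∧
            l'.length + 1 = (sl S').length}), phi d A (sl S) y = 0 := by
          intro y hy
          induction hy using Submodule.span_induction with
          | mem x hx =>
            obtain ⟨T, ⟨h5, h6⟩, rfl⟩ := hx
            by_contra hne
            have := (phi_perm _ _ ((good_sl S').sublist h5).nodup hne).length_eq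
            omega
          | zero => simp
          | add x y _ _ hx hy => rw [map_add, hx, hy, add_zero]
          | smul a x _ hx => rw [map_smul, hx, smul_zero]
        rw [h4 _ h3, smul_zero]
      rw [this, zero_smul]
  have : x' = 0 := by
    have h := bd_gen_mul H x'
    rw [hHx, hbd, map_zero, mul_zero, sub_zero] at h
    exact h.symm
  rw [this, map_zero]

end sec
/-! ### The converse direction -/

section back
variable {d s : ℕ} {A : Finset (Hyp d)} {blk : ↥A → Fin s}

noncomputable def zvec (a b : Fin s → ↥A) (i : Fin s) : ↥A → ℤ :=
  Pi.single (a i) 1 - Pi.single (b i) 1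

noncomputable def zl (d : ℕ) (A : Finset (Hyp d)) (a b : Fin s → ↥A) (L : List (Fin s)) : EA d A :=
  ((L.map (zvec a b)).map (ExteriorAlgebra.ι ℤ)).prod

lemma iota_zvec (a b : Fin s → ↥A) (i : Fin s) :
    ExteriorAlgebra.ι ℤ (zvec a b i) = gen d A (a i) - gen d A (b i) := by
  rw [zvec, map_sub]; rfl

lemma zl_cons (a b : Fin s → ↥A) (i : Fin s) (L : List (Fin s)) :
    zl d A a b (i :: L) = ExteriorAlgebra.ι ℤ (zvec a b i) * zl d A a b L := by
  simp [zl]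

lemma zl_mem (a b : Fin s → ↥A) (L : List (Fin s)) (ha : ∀ i ∈ L, blk (a i) = i)
    (hb : ∀ i ∈ L, blk (b i) = i) :
    zl d A a b L ∈ Submodule.span ℤ (mon d A '' {T | T.map blk = L}) := by
  induction L with
  | nil => exact Submodule.subset_span ⟨[], rfl, rfl⟩
  | cons i L ih =>
    rw [zl_cons, iota_zvec]
    have h0 := ih (fun j hj => ha j (by simp [hj])) (fun j hj => hb j (by simp [hj]))
    have h1 : ∀ H : ↥A, blk H = i → ∀ x ∈ Submodule.span ℤ (mon d A '' {T | T.map blk = L}),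
        gen d A H * x ∈ Submodule.span ℤ (mon d A '' {T | T.map blk = i :: L}) := by
      intro H hH x hx
      induction hx using Submodule.span_induction with
      | mem x hx =>
        obtain ⟨T, hT, rfl⟩ := hx
        rw [← mon_cons]
        refine Submodule.subset_span ⟨H :: T, ?_, rfl⟩
        simp only [Set.mem_setOf_eq] at hT ⊢
        rw [List.map_cons, hT, hH]
      | zero => simp
      | add x y _ _ hx hy => rw [mul_add]; exact add_mem hx hy
      | smul a x _ hx => rw [mul_smul_comm]; exact Submodule.smul_mem _ _ hx
    rw [sub_mul]
    exact sub_mem (h1 _ (ha i (by simp)) _ h0) (h1 _ (hb i (by simp)) _ h0)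

lemma zl_rho (p : ↥A → Prop) (a b : Fin s → ↥A) (L : List (Fin s)) (ha : ∀ i ∈ L, p (a i))
    (hb : ∀ i ∈ L, p (b i)) : rho d A p (zl d A a b L) = zl d A a b L := by
  induction L with
  | nil => simp [zl]
  | cons i L ih =>
    rw [zl_cons, map_mul, ih (fun j hj => ha j (by simp [hj])) (fun j hj => hb j (by simp [hj])),
      iota_zvec, map_sub, rho_gen, rho_gen, if_pos (ha i (by simp)), if_pos (hb i (by simp))]

lemma zl_bd (a b : Fin s → ↥A) (L : List (Fin s)) : ctr d A (sumF d A) (zl d A a b L) = 0 := by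
  refine ctr_prod_zero _ _ ?_
  intro v hv
  obtain ⟨i, -, rfl⟩ := List.mem_map.1 hv
  rw [zvec, map_sub, sumF_single, sumF_single, sub_self]

lemma zl_phi (a b : Fin s → ↥A) (L : List (Fin s)) (hL : L.Nodup) (ha : ∀ i ∈ L, blk (a i) = i)
    (hb : ∀ i ∈ L, blk (b i) = i) (hab : ∀ i ∈ L, a i ≠ b i) :
    phi d A (L.map a) (zl d A a b L) = 1 := by
  induction L with
  | nil => simp [zl, phi_nil]
  | cons i L ih =>
    rw [List.nodup_cons] at hL
    have h0 : ctr d A (pr d A (a i)) (zl d A a b L) = 0 := by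
      refine ctr_prod_zero _ _ ?_
      intro v hv
      obtain ⟨j, hj, rfl⟩ := List.mem_map.1 hv
      have hij : i ≠ j := fun h => hL.1 (h ▸ hj)
      have h1 : a i ≠ a j := fun h => hij (by
        rw [← ha i (by simp), ← ha j (by simp [hj]), h])
      have h2 : a i ≠ b j := fun h => hij (by
        rw [← ha i (by simp), ← hb j (by simp [hj]), h])
      rw [zvec, map_sub, pr_single, pr_single, if_neg h1, if_neg h2, sub_zero]
    rw [List.map_cons, phi_cons, zl_cons, ctr_iota_mul, h0, mul_zero, sub_zero, zvec, map_sub,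
      pr_single, pr_single, if_pos rfl, if_neg (hab i (by simp)), sub_zero, one_smul]
    exact ih hL.2 (fun j hj => ha j (by simp [hj])) (fun j hj => hb j (by simp [hj]))
      (fun j hj => hab j (by simp [hj]))

lemma back_sing (hinj : ∀ x ∈ secM blk, mkOS d A x = 0 → x = 0)
    (hsurj : ∀ y : EA d A, ∃ m ∈ secM blk, mkOS d A m = mkOS d A y) (X : Hyp d) (H0 : ↥A)
    (hH0 : X ≤ H0.1) : ∃ H : ↥A, X ≤ H.1 ∧ ∀ K : ↥A, X ≤ K.1 → blk K = blk H → K = H := by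
  by_contra hcon
  push Not at hcon
  set J : List (Fin s) := (List.finRange s).filter (fun i => ∃ H : ↥A, X ≤ H.1 ∧ blk H = i) with hJ
  have hJn : J.Nodup := (List.nodup_finRange s).filter _
  have hmem : ∀ i, i ∈ J ↔ ∃ H : ↥A, X ≤ H.1 ∧ blk H = i := by
    intro i; simp [hJ]
  have hab : ∀ i, ∃ a b : ↥A, i ∈ J → (X ≤ a.1 ∧ X ≤ b.1 ∧ blk a = i ∧ blk b = i ∧ a ≠ b) := by
    intro i
    by_cases hi : i ∈ J
    · obtain ⟨H, hH, rfl⟩ := (hmem i).1 hi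
      obtain ⟨K, hK, hKH, hne⟩ := hcon H hH
      exact ⟨H, K, fun _ => ⟨hH, hK, rfl, hKH, hne.symm⟩⟩
    · exact ⟨H0, H0, fun h => absurd h hi⟩
  choose a b hab using hab
  set z := zl d A a b J with hz
  have hzM : z ∈ secM blk := by
    refine Submodule.span_mono (Set.image_mono ?_) (zl_mem (blk := blk) a b J
      (fun i hi => (hab i hi).2.2.1) (fun i hi => (hab i hi).2.2.2.1))
    intro T hT
    simp only [Set.mem_setOf_eq] at hT ⊢
    unfold Good
    rw [hT]
    exact hJn
  obtain ⟨m, hm, hmz⟩ := hsurj (gen d A H0 * z)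
  have h1 := mk_bd (mk_rho X hmz)
  rw [map_mul, rho_gen, if_pos hH0, zl_rho _ a b J (fun i hi => (hab i hi).1)
    (fun i hi => (hab i hi).2.1), bd_gen_mul, zl_bd, mul_zero, sub_zero] at h1
  have h2 : ctr d A (sumF d A) (rho d A (fun H => X ≤ H.1) m) = z := by
    rw [← sub_eq_zero]
    refine hinj _ (sub_mem (secM_ctr _ _ (secM_rho' _ _ hm)) hzM) ?_
    rw [map_sub, h1, sub_self]
  have h3 : phi d A (J.map a) z = 1 := zl_phi (blk := blk) a b J hJn
    (fun i hi => (hab i hi).2.2.1) (fun i hi => (hab i hi).2.2.2.1)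
    (fun i hi => (hab i hi).2.2.2.2)
  have h4 : ∀ y ∈ Submodule.span ℤ (mon d A '' {l | Good blk l ∧ ∀ H ∈ l, X ≤ H.1}),
      phi d A (J.map a) (ctr d A (sumF d A) y) = 0 := by
    intro y hy
    induction hy using Submodule.span_induction with
    | mem x hx =>
      obtain ⟨T, ⟨hT, hTX⟩, rfl⟩ := hx
      have hTl : T.length ≤ J.length := by
        have : (T.map blk).Subperm J := List.subperm_of_subset hT (by
          intro i hi
          obtain ⟨H, hH, rfl⟩ := List.mem_map.1 hi
          exact (hmem _).2 ⟨H, hTX H hH, rfl⟩)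
        simpa using this.length_le
      have h5 := ctr_mon_mem (sumF d A) T
      have h6 : ∀ y ∈ Submodule.span ℤ (mon d A '' {l' | l'.Sublist T ∧
          l'.length + 1 = T.length}), phi d A (J.map a) y = 0 := by
        intro y hy
        induction hy using Submodule.span_induction with
        | mem x hx =>
          obtain ⟨T', ⟨h5, h6⟩, rfl⟩ := hx
          by_contra hne
          have := (phi_perm _ _ (hT.sublist h5).nodup hne).length_eq
          rw [List.length_map] at this
          omega
        | zero => simp
        | add x y _ _ hx hy => rw [map_add, hx, hy, add_zero]
        | smul a x _ hx => rw [map_smul, hx, smul_zero]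
      exact h6 _ h5
    | zero => simp
    | add x y _ _ hx hy => rw [map_add, map_add, hx, hy, add_zero]
    | smul a x _ hx => rw [map_smul, map_smul, hx, smul_zero]
  have h5 := h4 _ (secM_rho (fun H => X ≤ H.1) m hm)
  rw [h2, h3] at h5
  exact one_ne_zero h5

end back

/-! ### The tensor product -/

section tensor
variable {d s : ℕ} {A : Finset (Hyp d)} {blk : ↥A → Fin s}

lemma linInd_gen (hd : A.Nonempty → 0 < d) (hhyp : ∀ H ∈ A, IsLinHyp d H) :
    LinearIndependent ℤ (fun H : ↥A => mkOS d A (gen d A H)) := by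
  rw [Fintype.linearIndependent_iff]
  intro g hg H
  have h1 : mkOS d A (∑ H, g H • gen d A H) = mkOS d A 0 := by
    rw [map_sum, map_zero, ← hg]
    exact Finset.sum_congr rfl fun H _ => map_smul _ _ _
  rw [← iota_eq_sum] at h1
  have h2 := congrArg TrivSqZeroExt.snd (mk_triv hd hhyp h1)
  rw [ExteriorAlgebra.toTrivSqZeroExt_ι, map_zero] at h2
  exact congrFun h2 H

lemma Bsub_eq (π : Fin s → Finset (Hyp d)) (hπ : ∀ (H : ↥A) i, H.1 ∈ π i ↔ blk H = i)
    (i : Fin s) : Submodule.span ℤ (Set.range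
      (fun H : {H : ↥A // blk H = i} => mkOS d A (gen d A H.1))) = Bsub d A π i := by
  unfold Bsub
  congr 1
  ext x
  constructor
  · rintro ⟨H, rfl⟩
    exact ⟨H.1, (hπ _ _).2 H.2, rfl⟩
  · rintro ⟨H, hH, rfl⟩
    exact ⟨⟨H, (hπ _ _).1 hH⟩, rfl⟩

noncomputable def bB (hd : A.Nonempty → 0 < d) (hhyp : ∀ H ∈ A, IsLinHyp d H) (π : Fin s → Finset (Hyp d))
    (hπ : ∀ (H : ↥A) i, H.1 ∈ π i ↔ blk H = i) (i : Fin s) :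
    Basis {H : ↥A // blk H = i} ℤ (Bsub d A π i) :=
  (Basis.span ((linInd_gen hd hhyp).comp (Subtype.val : {H : ↥A // blk H = i} → ↥A)
    Subtype.val_injective)).map (LinearEquiv.ofEq _ _ (Bsub_eq π hπ i))

lemma bB_apply (hd : A.Nonempty → 0 < d) (hhyp : ∀ H ∈ A, IsLinHyp d H) (π : Fin s → Finset (Hyp d))
    (hπ : ∀ (H : ↥A) i, H.1 ∈ π i ↔ blk H = i) (i : Fin s) (H : {H : ↥A // blk H = i}) :
    (bB hd hhyp π hπ i H : OS d A) = mkOS d A (gen d A H.1) := by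
  rw [bB, Basis.map_apply, LinearEquiv.coe_ofEq_apply, Basis.span_apply]
  rfl

noncomputable def bO (hd : A.Nonempty → 0 < d) (hhyp : ∀ H ∈ A, IsLinHyp d H) (π : Fin s → Finset (Hyp d))
    (hπ : ∀ (H : ↥A) i, H.1 ∈ π i ↔ blk H = i) (i : Fin s) :
    Basis (Option {H : ↥A // blk H = i}) ℤ (ℤ × Bsub d A π i) :=
  ((Basis.singleton PUnit.{1} ℤ).prod (bB hd hhyp π hπ i)).reindex
    ((Equiv.sumComm _ _).trans (Equiv.optionEquivSumPUnit.{0} _).symm)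

lemma bO_none (hd : A.Nonempty → 0 < d) (hhyp : ∀ H ∈ A, IsLinHyp d H) (π : Fin s → Finset (Hyp d))
    (hπ : ∀ (H : ↥A) i, H.1 ∈ π i ↔ blk H = i) (i : Fin s) :
    bO hd hhyp π hπ i none = (1, 0) := by
  simp [bO, Basis.prod_apply]

lemma bO_some (hd : A.Nonempty → 0 < d) (hhyp : ∀ H ∈ A, IsLinHyp d H) (π : Fin s → Finset (Hyp d))
    (hπ : ∀ (H : ↥A) i, H.1 ∈ π i ↔ blk H = i) (i : Fin s) (H : {H : ↥A // blk H = i}) :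
    bO hd hhyp π hπ i (some H) = (0, bB hd hhyp π hπ i H) := by
  simp [bO, Basis.prod_apply]

lemma prod_filterMap {α β M : Type*} [Monoid M] (L : List α) (f : α → Option β) (g : β → M) :
    ((L.filterMap f).map g).prod = (L.map (fun i => (f i).elim 1 g)).prod := by
  induction L with
  | nil => simp
  | cons a L ih =>
    cases h : f a <;> simp [h, ih]

lemma teraoMap_tprod (π : Fin s → Finset (Hyp d)) (f : ∀ i : Fin s, ℤ × ↥(Bsub d A π i)) :
    teraoMap d A π (PiTensorProduct.tprod ℤ f) =
      (List.ofFn fun i => (f i).1 • (1 : OS d A) + ((f i).2 : OS d A)).prod := by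
  unfold teraoMap
  refine (PiTensorProduct.lift.tprod _).trans ?_
  refine (MultilinearMap.mkPiAlgebraFin_apply (R := ℤ) (n := s) (A := OS d A) _).trans ?_
  rfl

lemma tensor_link (hd : A.Nonempty → 0 < d) (hhyp : ∀ H ∈ A, IsLinHyp d H) (π : Fin s → Finset (Hyp d))
    (hπ : ∀ (H : ↥A) i, H.1 ∈ π i ↔ blk H = i) :
    Function.Bijective (teraoMap d A π) ↔
      (∀ x ∈ secM blk, mkOS d A x = 0 → x = 0) ∧
      (∀ y : EA d A, ∃ m ∈ secM blk, mkOS d A m = mkOS d A y) := by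
  set tb := Basis.piTensorProduct (bO hd hhyp π hπ) with htb
  have h1 : ∀ S : Sec blk, teraoMap d A π (tb S) = mkOS d A (mon d A (sl S)) := by
    intro S
    rw [htb, Basis.piTensorProduct_apply, teraoMap_tprod, mon, map_list_prod,
      List.map_map, sl, prod_filterMap, List.ofFn_eq_map]
    congr 1
    refine List.map_congr_left fun i _ => ?_
    cases h : S i with
    | none =>
      rw [bO_none]
      simp
    | some H =>
      rw [bO_some]
      simp [bB_apply]
  let T : (⨂[ℤ] i : Fin s, (ℤ × ↥(Bsub d A π i))) →ₗ[ℤ] EA d A :=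
    tb.constr ℤ (fun S => mon d A (sl S))
  have hTb : ∀ S, T (tb S) = mon d A (sl S) := fun S => tb.constr_basis ℤ _ S
  have hT : ∀ t, teraoMap d A π t = mkOS d A (T t) := by
    intro t
    rw [← tb.sum_repr t, map_sum, map_sum, map_sum]
    refine Finset.sum_congr rfl fun S _ => ?_
    rw [map_zsmul, map_zsmul, map_zsmul, h1, hTb]
  have hTM : ∀ t, T t ∈ secM blk := by
    intro t
    rw [← tb.sum_repr t, map_sum]
    refine sum_mem fun S _ => ?_
    rw [map_smul, hTb]
    exact Submodule.smul_mem _ _ (Submodule.subset_span ⟨_, good_sl S, rfl⟩)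
  have hTs : ∀ x ∈ secM blk, ∃ t, T t = x := by
    intro x hx
    refine ⟨∑ S : Sec blk, phi d A (sl S) x • tb S, ?_⟩
    rw [map_sum]
    conv_rhs => rw [secM_expand x hx]
    exact Finset.sum_congr rfl fun S _ => by rw [map_smul, hTb]
  have hTi : ∀ t, T t = 0 → t = 0 := by
    intro t ht
    rw [← tb.sum_repr t, map_sum] at ht
    have : ∀ S, tb.repr t S = 0 := by
      intro S
      have h := congrArg (phi d A (sl S)) ht
      rw [map_sum, map_zero, Finset.sum_eq_single S] at h
      · rwa [map_smul, hTb, map_smul, phi_sl, if_pos rfl, smul_eq_mul, mul_one] at h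
      · intro S' _ hS'
        rw [map_smul, hTb, map_smul, phi_sl, if_neg (Ne.symm hS'), smul_zero]
      · simp
    rw [← tb.sum_repr t]
    exact Finset.sum_eq_zero fun S _ => by rw [this, zero_smul]
  constructor
  · rintro ⟨hi, hs⟩
    refine ⟨?_, ?_⟩
    · intro x hx hx0
      obtain ⟨t, rfl⟩ := hTs x hx
      have : t = 0 := hi (by rw [hT, hx0, map_zero])
      rw [this, map_zero]
    · intro y
      obtain ⟨t, ht⟩ := hs (mkOS d A y)
      exact ⟨T t, hTM t, by rw [← hT, ht]⟩
  · rintro ⟨hi, hs⟩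
    refine ⟨?_, ?_⟩
    · rw [injective_iff_map_eq_zero]
      intro t ht
      rw [hT] at ht
      exact hTi t (hi _ (hTM t) ht)
    · intro y
      obtain ⟨y, rfl⟩ := RingQuot.mkAlgHom_surjective ℤ (osRel d A) y
      obtain ⟨m, hm, hmy⟩ := hs y
      obtain ⟨t, rfl⟩ := hTs m hm
      exact ⟨t, by rw [hT, hmy]⟩

end tensor
/-! ### Assembling the theorem -/

section final
variable {d s : ℕ} {A : Finset (Hyp d)} {blk : ↥A → Fin s}

lemma degenerate (π : Fin s → Finset (Hyp d)) (hd : d = 0) (hA : A.Nonempty) :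
    ¬ Function.Injective (teraoMap d A π) := by
  intro hinj
  obtain ⟨H, hH⟩ := hA
  have h0 : mkOS d A 1 = 0 := by
    have h1 : arrRank d (hs [(⟨H, hH⟩ : ↥A)]) < [(⟨H, hH⟩ : ↥A)].length := by
      have : arrRank d (hs [(⟨H, hH⟩ : ↥A)]) ≤ d := Nat.sub_le _ _
      simp only [List.length_singleton]
      omega
    have h2 := mk_bd_dep _ h1
    rwa [mon_cons, mon_nil, bd_gen_mul, ctr_one, mul_zero, sub_zero] at h2
  rw [map_one] at h0
  have h1 : PiTensorProduct.tprod ℤ (fun i : Fin s => ((1, 0) : ℤ × ↥(Bsub d A π i))) = 0 := by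
    apply hinj
    rw [map_zero, ← mul_one (teraoMap d A π _), h0, mul_zero]
  have h2 := congrArg (PiTensorProduct.lift ((MultilinearMap.mkPiAlgebra ℤ (Fin s) ℤ).compLinearMap
    (fun i => LinearMap.fst ℤ ℤ ↥(Bsub d A π i)))) h1
  rw [map_zero] at h2
  have h3 := (PiTensorProduct.lift.tprod (R := ℤ) _).symm.trans h2
  simp at h3

lemma fwd (hd : A.Nonempty → 0 < d) (hhyp : ∀ H ∈ A, IsLinHyp d H)
    (hne : ∀ i, ∃ H : ↥A, blk H = i)
    (hI : ∀ c : Fin s → ↥A, (∀ i, blk (c i) = i) →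
      arrRank d (Finset.image (fun i => (c i).1) Finset.univ) = s)
    (hsing : ∀ l : List ↥A, l ≠ [] → ∃ H : ↥A, (hs l).inf id ≤ H.1 ∧
      ∀ K : ↥A, (hs l).inf id ≤ K.1 → blk K = blk H → K = H) :
    (∀ x ∈ secM blk, mkOS d A x = 0 → x = 0) ∧
      (∀ y : EA d A, ∃ m ∈ secM blk, mkOS d A m = mkOS d A y) := by
  have hind : ∀ T : List ↥A, Good blk T → arrRank d (hs T) = T.length := by
    intro T hT
    have hc : ∀ i, ∃ H : ↥A, blk H = i ∧ ∀ K ∈ T, blk K = i → H = K := by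
      intro i
      by_cases h : ∃ K ∈ T, blk K = i
      · obtain ⟨K, hK, rfl⟩ := h
        refine ⟨K, rfl, fun K' hK' hb => ?_⟩
        exact (List.inj_on_of_nodup_map hT hK' hK hb).symm
      · obtain ⟨H, hH⟩ := hne i
        exact ⟨H, hH, fun K hK hb => absurd ⟨K, hK, hb⟩ h⟩
    choose c hc1 hc2 using hc
    have h1 := hI c hc1
    set C := Finset.image (fun i => (c i).1) Finset.univ with hC
    have hsub : hs T ⊆ C := by
      intro H hH
      obtain ⟨K, hK, rfl⟩ := (mem_hs _ _).1 hH
      rw [hC, Finset.mem_image]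
      exact ⟨blk K, Finset.mem_univ _, by rw [hc2 _ K hK rfl]⟩
    have hCA : ∀ H ∈ C \ hs T, IsLinHyp d H := by
      intro H hH
      rw [Finset.mem_sdiff, hC, Finset.mem_image] at hH
      obtain ⟨⟨i, -, rfl⟩, -⟩ := hH
      exact hhyp _ (c i).2
    have h2 := arrRank_union_le (hs T) (C \ hs T) hCA
    rw [Finset.union_sdiff_of_subset hsub, h1] at h2
    have h3 := Finset.card_sdiff_add_card_eq_card hsub
    have h4 : C.card ≤ s := by
      simpa using (Finset.card_image_le (s := Finset.univ) (f := fun i => (c i).1))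
    have h5 : (hs T).card = T.length := by
      unfold hs
      rw [List.toFinset_card_of_nodup (hT.nodup.map Subtype.val_injective), List.length_map]
    have h6 := rank_hs_le hhyp T
    omega
  refine ⟨?_, ?_⟩
  · intro x hx h0
    rw [secM_expand x hx]
    refine Finset.sum_eq_zero fun S _ => ?_
    rw [inj_fwd hd hhyp hind hsing _ x hx h0 (sl S) (good_sl S) rfl, zero_smul]
  · intro y
    have hy : y ∈ Submodule.span ℤ (Set.range (mon d A)) := by rw [mon_span]; trivial
    induction hy using Submodule.span_induction with
    | mem y hy =>
      obtain ⟨l, rfl⟩ := hy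
      have h1 := span_fwd (blk := blk) hhyp hsing _ l rfl
      have h2 : ∀ z ∈ Submodule.span ℤ ((fun T => mkOS d A (mon d A T)) ''
          {T | Good blk T ∧ ∀ H ∈ T, (hs l).inf id ≤ H.1}), ∃ m ∈ secM blk, mkOS d A m = z := by
        intro z hz
        induction hz using Submodule.span_induction with
        | mem z hz =>
          obtain ⟨T, ⟨hT, -⟩, rfl⟩ := hz
          exact ⟨_, Submodule.subset_span ⟨T, hT, rfl⟩, rfl⟩
        | zero => exact ⟨0, zero_mem _, map_zero _⟩
        | add x y _ _ hx hy =>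
          obtain ⟨a, ha, rfl⟩ := hx
          obtain ⟨b, hb, rfl⟩ := hy
          exact ⟨a + b, add_mem ha hb, map_add _ _ _⟩
        | smul n x _ hx =>
          obtain ⟨a, ha, rfl⟩ := hx
          exact ⟨n • a, Submodule.smul_mem _ _ ha, map_zsmul _ _ _⟩
      exact h2 _ h1
    | zero => exact ⟨0, zero_mem _, rfl⟩
    | add x y _ _ hx hy =>
      obtain ⟨a, ha, h1⟩ := hx
      obtain ⟨b, hb, h2⟩ := hy
      exact ⟨a + b, add_mem ha hb, by rw [map_add, map_add, h1, h2]⟩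
    | smul n x _ hx =>
      obtain ⟨a, ha, h1⟩ := hx
      exact ⟨n • a, Submodule.smul_mem _ _ ha, by rw [map_zsmul, map_zsmul, h1]⟩

lemma back_ind (hhyp : ∀ H ∈ A, IsLinHyp d H)
    (hinj : ∀ x ∈ secM blk, mkOS d A x = 0 → x = 0)
    (c : Fin s → ↥A) (hc : ∀ i, blk (c i) = i) :
    arrRank d (Finset.image (fun i => (c i).1) Finset.univ) = s := by
  have hg : Good blk (List.ofFn c) := by
    unfold Good
    rw [List.map_ofFn, List.nodup_ofFn]
    intro i j hij
    simpa [hc] using hij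
  have h1 : hs (List.ofFn c) = Finset.image (fun i => (c i).1) Finset.univ := by
    ext H
    simp [mem_hs, List.mem_ofFn]
  rw [← h1]
  have h2 := rank_hs_le hhyp (List.ofFn c)
  rw [List.length_ofFn] at h2
  refine le_antisymm h2 (not_lt.1 fun hlt => ?_)
  have h3 := mk_dep (List.ofFn c) (by rwa [List.length_ofFn])
  have h4 := hinj _ (Submodule.subset_span ⟨_, hg, rfl⟩) h3
  have h5 := phi_self (d := d) (List.ofFn c) hg.nodup
  rw [h4, map_zero] at h5
  exact zero_ne_one h5

end final

/-- Terao's factorization theorem: a partition π of a central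
arrangement A is nice (independent, and every nonempty localization A_X induces a
partition with a singleton block) if and only if the canonical map
`(ℤ ⊕ B(π_1)) ⊗ ⋯ ⊗ (ℤ ⊕ B(π_s)) → A(A)` is an isomorphism of ℤ-modules. -/
theorem stmt16 (d s : ℕ) (A : Finset (Hyp d)) (hhyp : ∀ H ∈ A, IsLinHyp d H)
    (π : Fin s → Finset (Hyp d))
    (hblocks : ∀ i, (π i).Nonempty)
    (hdisj : ∀ i j : Fin s, i ≠ j → Disjoint (π i) (π j))
    (hcover : ∀ H : Hyp d, H ∈ A ↔ ∃ i, H ∈ π i) :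
    ((∀ c : Fin s → Hyp d, (∀ i, c i ∈ π i) →
        arrRank d (Finset.image c Finset.univ) = s) ∧
      (∀ X : Hyp d, (∃ S ⊆ A, X = S.inf id) →
        (A.filter (fun H => X ≤ H)).Nonempty →
        ∃ i, ((π i).filter (fun H => X ≤ H)).card = 1)) ↔
    Function.Bijective (teraoMap d A π) := by
  have hblk : ∀ H : ↥A, ∃ i, H.1 ∈ π i := fun H => (hcover H.1).1 H.2
  choose blk hblk using hblk
  have hπ : ∀ (H : ↥A) i, H.1 ∈ π i ↔ blk H = i := by
    intro H i
    constructor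
    · intro h
      by_contra hne
      exact Finset.disjoint_left.1 (hdisj _ _ hne) (hblk H) h
    · rintro rfl
      exact hblk H
  have hπA : ∀ i, ∀ H ∈ π i, H ∈ A := fun i H hH => (hcover H).2 ⟨i, hH⟩
  by_cases hd : A.Nonempty → 0 < d
  · rw [tensor_link hd hhyp π hπ]
    constructor
    · rintro ⟨hI, hS⟩
      refine fwd hd hhyp ?_ ?_ ?_
      · intro i
        obtain ⟨H, hH⟩ := hblocks i
        exact ⟨⟨H, hπA i H hH⟩, (hπ _ _).1 hH⟩
      · intro c hc
        exact hI _ fun i => (hπ _ _).2 (hc i)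
      · intro l hl
        obtain ⟨i, hi⟩ := hS ((hs l).inf id) ⟨hs l, hs_subset l, rfl⟩ (by
          obtain ⟨K, hK⟩ := List.exists_mem_of_ne_nil l hl
          exact ⟨K.1, Finset.mem_filter.2 ⟨K.2,
            Finset.inf_le (f := id) ((mem_hs _ _).2 ⟨K, hK, rfl⟩)⟩⟩)
        obtain ⟨H, hH⟩ := Finset.card_eq_one.1 hi
        have hHm : H ∈ (π i).filter (fun H => (hs l).inf id ≤ H) := by rw [hH]; simp
        rw [Finset.mem_filter] at hHm
        refine ⟨⟨H, hπA i H hHm.1⟩, hHm.2, fun K hK hb => ?_⟩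
        have hbi : blk ⟨H, hπA i H hHm.1⟩ = i := (hπ _ _).1 hHm.1
        have hKm : K.1 ∈ (π i).filter (fun H => (hs l).inf id ≤ H) :=
          Finset.mem_filter.2 ⟨(hπ _ _).2 (hb.trans hbi), hK⟩
        rw [hH, Finset.mem_singleton] at hKm
        exact Subtype.ext hKm
    · rintro ⟨hinj, hsurj⟩
      refine ⟨?_, ?_⟩
      · intro c hc
        exact back_ind hhyp hinj (fun i => ⟨c i, hπA i _ (hc i)⟩) (fun i => (hπ _ _).1 (hc i))
      · rintro X - ⟨H0, hH0⟩
        rw [Finset.mem_filter] at hH0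
        obtain ⟨H, hH, hu⟩ := back_sing hinj hsurj X ⟨H0, hH0.1⟩ hH0.2
        refine ⟨blk H, Finset.card_eq_one.2 ⟨H.1, ?_⟩⟩
        ext K
        rw [Finset.mem_filter, Finset.mem_singleton]
        constructor
        · rintro ⟨h1, h2⟩
          exact congrArg Subtype.val (hu ⟨K, hπA _ _ h1⟩ h2 ((hπ _ _).1 h1))
        · rintro rfl
          exact ⟨hblk H, hH⟩
  · push Not at hd
    obtain ⟨hA, hd⟩ := hd
    have hd0 : d = 0 := by omega
    refine iff_of_false ?_ fun h => degenerate π hd0 hA h.1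
    rintro ⟨hI, -⟩
    obtain ⟨H, hH⟩ := hA
    obtain ⟨i, -⟩ := (hcover H).1 hH
    choose c hc using hblocks
    have h1 := hI c hc
    have h2 : arrRank d (Finset.image c Finset.univ) ≤ d := Nat.sub_le _ _
    have := i.2
    omega
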